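/- Let p ≤ 13 and let η be a polynomial of degree ≤ p on [-1,1] with η(-1) = 0 and η not identically zero. Let S(η) be the maximizer of J(ψ;η) = ∫_{-1}^{1}(η ψ - (1/4)(η-ψ)²) dx over all polynomials ψ of degree ≤ p-1 satisfying ψ(1) = η(1). Then J(S(η); η) > 0. -/

import Mathlib

open Polynomial intervalIntegral

/-- The `L²` inner product of real polynomials on `[-1, 1]`. -/
noncomputable def polyInner : ℝ[X] →ₗ[ℝ] ℝ[X] →ₗ[ℝ] ℝ :=
  LinearMap.mk₂ ℝ (fun f g ↦ ∫ x in (-1 : ℝ)..1, f.eval x * g.eval x)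
    (fun f₁ f₂ g ↦ by
      simp only [eval_add, add_mul]
      exact integral_add (Continuous.intervalIntegrable (by fun_prop) _ _)
        (Continuous.intervalIntegrable (by fun_prop) _ _))
    (fun c f g ↦ by simp [mul_assoc])
    (fun f g₁ g₂ ↦ by
      simp only [eval_add, mul_add]
      exact integral_add (Continuous.intervalIntegrable (by fun_prop) _ _)
        (Continuous.intervalIntegrable (by fun_prop) _ _))
    (fun c f g ↦ by simp [mul_left_comm])

lemma polyInner_apply (f g : ℝ[X]) :
    polyInner f g = ∫ x in (-1 : ℝ)..1, f.eval x * g.eval x := rfl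

lemma polyInner_comm (f g : ℝ[X]) : polyInner f g = polyInner g f := by
  simp only [polyInner_apply, mul_comm]

lemma polyInner_self_nonneg (f : ℝ[X]) : 0 ≤ polyInner f f :=
  integral_nonneg (by norm_num) fun x _ ↦ mul_self_nonneg (f.eval x)

lemma polyInner_self_pos {f : ℝ[X]} (hf : f ≠ 0) : 0 < polyInner f f := by
  obtain ⟨c, hc, hfc⟩ : ∃ c ∈ Set.Icc (-1 : ℝ) 1, f.eval c ≠ 0 := by
    by_contra! h
    exact hf (f.eq_zero_of_infinite_isRoot ((Set.Icc_infinite (by norm_num)).mono h))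
  exact integral_pos (by norm_num) (by fun_prop) (fun x _ ↦ mul_self_nonneg (f.eval x))
    ⟨c, hc, mul_self_pos.2 hfc⟩

lemma integral_eval_derivative_mul (a b : ℝ) (f g : ℝ[X]) :
    ∫ x in a..b, (derivative f).eval x * g.eval x =
      f.eval b * g.eval b - f.eval a * g.eval a -
        ∫ x in a..b, f.eval x * (derivative g).eval x := by
  rw [integral_mul_deriv_eq_deriv_mul (fun x _ ↦ f.hasDerivAt x) (fun x _ ↦ g.hasDerivAt x)
    (Continuous.intervalIntegrable (by fun_prop) _ _)
    (Continuous.intervalIntegrable (by fun_prop) _ _)]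
  ring

lemma polyInner_derivative_left (f g : ℝ[X]) :
    polyInner (derivative f) g =
      f.eval 1 * g.eval 1 - f.eval (-1) * g.eval (-1) - polyInner f (derivative g) :=
  integral_eval_derivative_mul _ _ f g

lemma integral_iterate_derivative_mul_eq_zero (a b : ℝ) (w : ℝ[X]) (n : ℕ)
    (ha : ∀ j < n, (derivative^[j] w).eval a = 0) (hb : ∀ j < n, (derivative^[j] w).eval b = 0)
    (q : ℝ[X]) (hq : q.natDegree < n) :
    ∫ x in a..b, (derivative^[n] w).eval x * q.eval x = 0 := by
  induction n generalizing q with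
  | zero => omega
  | succ k ih =>
    rw [Function.iterate_succ_apply', integral_eval_derivative_mul, ha k (by omega),
      hb k (by omega)]
    rcases Nat.eq_zero_or_pos q.natDegree with h0 | h0
    · simp [derivative_of_natDegree_zero h0]
    · rw [ih (fun j hj ↦ ha j (by omega)) (fun j hj ↦ hb j (by omega)) (derivative q)
        (by have := natDegree_derivative_le q; omega)]
      ring

lemma integral_shiftedLegendre_mul_eq_zero (n : ℕ) (q : ℝ[X]) (hq : q.natDegree < n) :
    ∫ x in (0 : ℝ)..1, ((shiftedLegendre n).map (Int.castRingHom ℝ)).eval x * q.eval x = 0 := by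
  have hrod := congrArg (Polynomial.map (Int.castRingHom ℝ)) (factorial_mul_shiftedLegendre_eq n)
  rw [← Polynomial.iterate_derivative_map] at hrod
  simp only [Polynomial.map_mul, Polynomial.map_pow, Polynomial.map_natCast, map_X,
    Polynomial.map_sub, Polynomial.map_one, ← mul_pow] at hrod
  have hvanish : ∀ x : ℝ, x * (1 - x) = 0 → ∀ j < n,
      (derivative^[j] ((X * (1 - X) : ℝ[X]) ^ n)).eval x = 0 := by
    intro x hx j hj
    obtain ⟨r, hr⟩ := pow_sub_dvd_iterate_derivative_pow (X * (1 - X) : ℝ[X]) n j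
    simp [hr, hx, Nat.sub_ne_zero_of_lt hj]
  have h := integral_iterate_derivative_mul_eq_zero 0 1 _ n (hvanish 0 (by simp))
    (hvanish 1 (by simp)) q hq
  rw [← hrod] at h
  simpa [mul_assoc, Nat.factorial_ne_zero] using h

/-- The Legendre polynomial of degree `n`, normalized to take the value `1` at `1`. -/
noncomputable def legendre (n : ℕ) : ℝ[X] :=
  ((shiftedLegendre n).map (Int.castRingHom ℝ)).comp (C (1 / 2) - C (1 / 2) * X)

lemma eval_shiftedLegendre_symm (n : ℕ) (x : ℝ) :
    ((shiftedLegendre n).map (Int.castRingHom ℝ)).eval x =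
      (-1) ^ n * ((shiftedLegendre n).map (Int.castRingHom ℝ)).eval (1 - x) := by
  simpa [aeval_def, eval_map] using shiftedLegendre_eval_symm n x

lemma legendre_eval_neg (n : ℕ) (x : ℝ) :
    (legendre n).eval (-x) = (-1) ^ n * (legendre n).eval x := by
  simp only [legendre, eval_comp, eval_sub, eval_mul, eval_C, eval_X]
  rw [eval_shiftedLegendre_symm]
  congr 2
  ring

lemma legendre_comp_neg (n : ℕ) : (legendre n).comp (-X) = C ((-1) ^ n) * legendre n :=
  Polynomial.funext fun x ↦ by simpa using legendre_eval_neg n x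

lemma legendre_eval_one (n : ℕ) : (legendre n).eval 1 = 1 := by
  simp [legendre, ← coeff_zero_eq_eval_zero, coeff_shiftedLegendre]

lemma legendre_eval_neg_one (n : ℕ) : (legendre n).eval (-1) = (-1) ^ n := by
  rw [legendre_eval_neg, legendre_eval_one, mul_one]

lemma legendre_derivative_eval_one (n : ℕ) :
    (derivative (legendre n)).eval 1 = n * (n + 1) / 2 := by
  have h : (derivative ((shiftedLegendre n).map (Int.castRingHom ℝ))).eval 0 = -(n * (n + 1)) := by
    rw [← coeff_zero_eq_eval_zero, coeff_derivative]
    simp [coeff_shiftedLegendre]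
  simp [legendre, derivative_comp, -derivative_map, h]
  ring

lemma legendre_derivative_eval_neg_one (n : ℕ) :
    (derivative (legendre n)).eval (-1) = -(-1) ^ n * (n * (n + 1) / 2) := by
  have h := congrArg (fun f ↦ (derivative f).eval 1) (legendre_comp_neg n)
  simp [derivative_comp, legendre_derivative_eval_one, -map_pow] at h
  linarith

lemma legendre_natDegree (n : ℕ) : (legendre n).natDegree = n := by
  have h1 : (C (1 / 2 : ℝ) - C (1 / 2) * X).natDegree = 1 := by
    rw [sub_eq_neg_add, ← neg_mul, ← C_neg]
    exact natDegree_linear (by norm_num)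
  rw [legendre, natDegree_comp, h1,
    natDegree_map_eq_of_injective (RingHom.injective_int _), natDegree_shiftedLegendre, mul_one]

lemma polyInner_legendre_eq_zero (n : ℕ) (q : ℝ[X]) (hq : q.natDegree < n) :
    polyInner (legendre n) q = 0 := by
  have hlin : (C (1 : ℝ) - C 2 * X).natDegree ≤ 1 := by compute_degree
  have h := integral_shiftedLegendre_mul_eq_zero n (q.comp (C 1 - C 2 * X))
    ((natDegree_comp_le.trans (Nat.mul_le_mul_left _ hlin)).trans_lt (by omega))
  have hsub := integral_comp_sub_mul (a := -1) (b := 1) (c := (1 / 2 : ℝ))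
    (fun x ↦ ((shiftedLegendre n).map (Int.castRingHom ℝ)).eval x *
      (q.comp (C 1 - C 2 * X)).eval x) (by norm_num) (1 / 2)
  norm_num at hsub
  rw [polyInner_apply]
  norm_num at h
  rw [h] at hsub
  rw [← mul_zero (2 : ℝ), ← hsub]
  congr 1
  funext x
  simp only [legendre, eval_comp, eval_sub, eval_mul, eval_C, eval_X]
  norm_num
  ring_nf
  simp

lemma polyInner_derivative_legendre (n : ℕ) (q : ℝ[X]) (hq : q.natDegree ≤ n) :
    polyInner (derivative (legendre n)) q = q.eval 1 - (-1) ^ n * q.eval (-1) := by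
  have h : polyInner (legendre n) (derivative q) = 0 := by
    rcases Nat.eq_zero_or_pos q.natDegree with h0 | h0
    · simp [derivative_of_natDegree_zero h0]
    · exact polyInner_legendre_eq_zero n _ (by have := natDegree_derivative_le q; omega)
  rw [polyInner_derivative_left, h, legendre_eval_one, legendre_eval_neg_one]
  ring

lemma legendre_coeff_ne_zero (n : ℕ) : (legendre n).coeff n ≠ 0 := by
  intro h
  have hlead : (legendre n).leadingCoeff = 0 := by rw [leadingCoeff, legendre_natDegree, h]
  rw [leadingCoeff_eq_zero] at hlead
  simpa [hlead] using legendre_eval_one n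

lemma natDegree_sub_C_mul_legendre_lt {n : ℕ} (hn : 0 < n) (f : ℝ[X]) (hf : f.natDegree ≤ n) :
    (f - C (f.coeff n / (legendre n).coeff n) * legendre n).natDegree < n := by
  refine lt_of_le_of_ne ((natDegree_sub_le _ _).trans (max_le hf
    ((natDegree_C_mul_le _ _).trans (legendre_natDegree n).le))) fun h ↦ ?_
  have h0 : (f - C (f.coeff n / (legendre n).coeff n) * legendre n).coeff n = 0 := by
    simp [legendre_coeff_ne_zero]
  generalize f - C (f.coeff n / (legendre n).coeff n) * legendre n = g at h h0
  rw [← h, coeff_natDegree, leadingCoeff_eq_zero] at h0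
  simp [h0] at h
  omega

lemma polyInner_legendre_self (n : ℕ) :
    polyInner (legendre n) (legendre n) = 2 / (2 * n + 1) := by
  have hX : polyInner (legendre n) (X * derivative (legendre n)) =
      n * polyInner (legendre n) (legendre n) := by
    rcases Nat.eq_zero_or_pos n with rfl | hn
    · simp [derivative_of_natDegree_zero (legendre_natDegree 0)]
    have hdeg : (X * derivative (legendre n) - C (n : ℝ) * legendre n).natDegree < n := by
      have := natDegree_sub_C_mul_legendre_lt hn (X * derivative (legendre n)) (by
        have := natDegree_derivative_le (legendre n)
        rw [legendre_natDegree] at this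
        refine natDegree_mul_le.trans ?_
        rw [natDegree_X]
        omega)
      obtain ⟨m, rfl⟩ : ∃ m, n = m + 1 := ⟨n - 1, by omega⟩
      rw [coeff_X_mul, coeff_derivative, mul_div_cancel_left₀ _ (legendre_coeff_ne_zero _)] at this
      simpa using this
    have h := polyInner_legendre_eq_zero n _ hdeg
    rw [← smul_eq_C_mul, map_sub, map_smul, smul_eq_mul] at h
    linarith
  have hparts := polyInner_derivative_left (legendre n) (X * legendre n)
  have hone : polyInner (legendre n) (derivative (X * legendre n)) =
      polyInner (legendre n) (legendre n) +
        polyInner (legendre n) (X * derivative (legendre n)) := by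
    simp [derivative_mul]
  have hswap : polyInner (derivative (legendre n)) (X * legendre n) =
      polyInner (legendre n) (X * derivative (legendre n)) := by
    simp only [polyInner_apply, eval_mul, eval_X]
    congr 1
    funext x
    ring
  rw [hone, hswap, hX, eval_mul, eval_mul, legendre_eval_one, legendre_eval_neg_one] at hparts
  have hsq : ((-1 : ℝ) ^ n) * (-1) ^ n = 1 := by rw [← mul_pow]; simp
  rw [eq_div_iff (by positivity)]
  simp only [eval_X] at hparts
  linear_combination hparts + hsq

lemma integral_functional_eq (f g : ℝ[X]) :
    (∫ x in (-1 : ℝ)..1, (f.eval x * g.eval x - (1 / 4) * (f.eval x - g.eval x) ^ 2)) =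
      3 / 2 * polyInner f g - 1 / 4 * polyInner g g - 1 / 4 * polyInner f f := by
  have h : polyInner f g - 1 / 4 * polyInner (f - g) (f - g) =
      ∫ x in (-1 : ℝ)..1, (f.eval x * g.eval x - (1 / 4) * (f.eval x - g.eval x) ^ 2) := by
    rw [polyInner_apply, polyInner_apply, ← integral_const_mul, ← integral_sub
      (Continuous.intervalIntegrable (by fun_prop) _ _)
      (Continuous.intervalIntegrable (by fun_prop) _ _)]
    simp [pow_two]
  rw [← h]
  simp only [map_sub, LinearMap.sub_apply, polyInner_comm g f]
  ring

lemma quadratic_form_nonneg {a b c : ℝ} (ha : 0 < a) (h : b ^ 2 ≤ 4 * a * c) (u v : ℝ) :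
    0 ≤ a * u ^ 2 + b * (u * v) + c * v ^ 2 := by
  have h1 : 0 ≤ 4 * a * (a * u ^ 2 + b * (u * v) + c * v ^ 2) := by
    nlinarith [sq_nonneg (2 * a * u + b * v), mul_nonneg (sub_nonneg.2 h) (sq_nonneg v)]
  exact nonneg_of_mul_nonneg_right h1 (by positivity)

/-- The margin `1 / 1000` makes the bound strict as soon as the left-hand side is nonzero; the
inequality is where the restriction on the degree enters. -/
lemma quadratic_form_le {m : ℕ} (hm : m ≤ 12) {u v : ℝ} (hu : m = 0 → u = 0) :
    (v - u) ^ 2 / (8 * (2 * m + 3)) + (3 * u + v) ^ 2 / (8 * (m + 1) ^ 2) ≤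
      (2 - 1 / 1000) * (u ^ 2 / (m * (m + 1)) + v ^ 2 / ((m + 1) * (m + 2))) := by
  rcases Nat.eq_zero_or_pos m with rfl | hpos
  · simp only [hu rfl]
    norm_num
    nlinarith [sq_nonneg v]
  · have h := quadratic_form_nonneg
      (a := (2 - 1 / 1000) / (m * (m + 1)) - 1 / (8 * (2 * m + 3)) - 9 / (8 * (m + 1) ^ 2))
      (b := 2 / (8 * (2 * m + 3)) - 6 / (8 * (m + 1) ^ 2))
      (c := (2 - 1 / 1000) / ((m + 1) * (m + 2)) - 1 / (8 * (2 * m + 3)) - 1 / (8 * (m + 1) ^ 2))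
      (by interval_cases m <;> norm_num) (by interval_cases m <;> norm_num) u v
    rw [← sub_nonneg]
    refine h.trans_eq ?_
    ring

lemma natDegree_derivative_legendre_le (n : ℕ) : (derivative (legendre n)).natDegree ≤ n - 1 := by
  simpa only [legendre_natDegree] using natDegree_derivative_le (legendre n)

lemma neg_one_pow_mul_self_real (m : ℕ) : (-1 : ℝ) ^ m * (-1) ^ m = 1 := by
  rw [← mul_pow]
  simp

lemma polyInner_derivative_legendre_self (n : ℕ) :
    polyInner (derivative (legendre n)) (derivative (legendre n)) = n * (n + 1) := by
  rw [polyInner_derivative_legendre n _ ((natDegree_derivative_legendre_le n).trans (by omega)),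
    legendre_derivative_eval_one, legendre_derivative_eval_neg_one]
  linear_combination (n * (n + 1) / 2 : ℝ) * neg_one_pow_mul_self_real n

lemma polyInner_derivative_legendre_succ (m : ℕ) :
    polyInner (derivative (legendre (m + 1))) (derivative (legendre m)) = 0 := by
  rw [polyInner_derivative_legendre (m + 1) _
      ((natDegree_derivative_legendre_le m).trans (by omega)),
    legendre_derivative_eval_one, legendre_derivative_eval_neg_one, pow_succ]
  linear_combination (-(m * (m + 1) / 2) : ℝ) * neg_one_pow_mul_self_real m

lemma polyInner_derivative_legendre_succ_left (m : ℕ) (r : ℝ[X]) (hr : r.natDegree ≤ m) :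
    polyInner (derivative (legendre (m + 1))) r = r.eval 1 + (-1) ^ m * r.eval (-1) := by
  rw [polyInner_derivative_legendre (m + 1) r (by omega), pow_succ]
  ring

/-- Bessel's inequality for the functionals representing the even and odd endpoint values. -/
lemma endpoint_bessel (m : ℕ) (r : ℝ[X]) (hr : r.natDegree ≤ m) :
    (r.eval 1 - (-1) ^ m * r.eval (-1)) ^ 2 / (m * (m + 1)) +
      (r.eval 1 + (-1) ^ m * r.eval (-1)) ^ 2 / ((m + 1) * (m + 2)) ≤ polyInner r r := by
  have hD := polyInner_derivative_legendre_succ_left m r hr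
  have hM := polyInner_derivative_legendre m r hr
  have hDD := polyInner_derivative_legendre_self (m + 1)
  have hMM := polyInner_derivative_legendre_self m
  have hDM := polyInner_derivative_legendre_succ m
  set D := derivative (legendre (m + 1))
  set M := derivative (legendre m)
  set v := r.eval 1 + (-1) ^ m * r.eval (-1)
  set u := r.eval 1 - (-1) ^ m * r.eval (-1)
  have h := polyInner_self_nonneg
    (r - (v / ((m + 1) * (m + 2))) • D - (u / (m * (m + 1))) • M)
  simp only [map_sub, map_smul, LinearMap.sub_apply, LinearMap.smul_apply, smul_eq_mul,
    polyInner_comm r, polyInner_comm M D, hD, hM, hDD, hMM, hDM] at h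
  have hv : (v / ((m + 1) * (m + 2))) * (v / ((m + 1) * (m + 2))) * ((m + 1) * (m + 2)) =
      v ^ 2 / ((m + 1) * (m + 2)) := by
    field_simp
  have hu : (u / (m * (m + 1))) * (u / (m * (m + 1))) * (m * (m + 1)) =
      u ^ 2 / (m * (m + 1)) := by
    rcases Nat.eq_zero_or_pos m with rfl | hm
    · simp
    · field_simp
  push_cast at h
  ring_nf at h hu hv ⊢
  linarith

theorem maximizer_value_pos (p : ℕ) (hp : p ≤ 13) (η ψ : Polynomial ℝ)
    (hηdeg : η.natDegree ≤ p) (hη0 : η.eval (-1) = 0) (hηne : η ≠ 0)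
    (hψdeg : ψ.natDegree ≤ p - 1) (hψ1 : ψ.eval 1 = η.eval 1)
    (hmax : ∀ φ : Polynomial ℝ, φ.natDegree ≤ p - 1 → φ.eval 1 = η.eval 1 →
      (∫ x in (-1:ℝ)..1, (η.eval x * φ.eval x - (1/4)*(η.eval x - φ.eval x)^2)) ≤
        ∫ x in (-1:ℝ)..1, (η.eval x * ψ.eval x - (1/4)*(η.eval x - ψ.eval x)^2)) :
    0 < ∫ x in (-1:ℝ)..1, (η.eval x * ψ.eval x - (1/4)*(η.eval x - ψ.eval x)^2) := by
  rcases Nat.eq_zero_or_pos p with rfl | hpos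
  · rw [eq_C_of_natDegree_le_zero hηdeg, eval_C] at hη0
    exact absurd (by rw [eq_C_of_natDegree_le_zero hηdeg, hη0, C_0]) hηne
  obtain ⟨m, rfl⟩ : ∃ m, p = m + 1 := ⟨p - 1, by omega⟩
  obtain ⟨a, r, hr, hη⟩ : ∃ (a : ℝ) (r : ℝ[X]), r.natDegree ≤ m ∧
      η = r + a • legendre (m + 1) :=
    ⟨_, _, Nat.le_of_lt_succ (natDegree_sub_C_mul_legendre_lt hpos η hηdeg), by
      rw [smul_eq_C_mul, sub_add_cancel]⟩
  have ha : a = (-1) ^ m * r.eval (-1) := by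
    simp only [hη, eval_add, eval_smul, smul_eq_mul, legendre_eval_neg_one, pow_succ] at hη0
    linear_combination (-(-1) ^ m) * hη0 - a * neg_one_pow_mul_self_real m
  have hrne : r ≠ 0 := by
    rintro rfl
    simp_all
  have hη1 : η.eval 1 = r.eval 1 + a := by simp [hη, legendre_eval_one]
  have hbessel := endpoint_bessel m r hr
  have hu : m = 0 → r.eval 1 - a = 0 := by
    rintro rfl
    rw [ha, eq_C_of_natDegree_le_zero hr]
    simp
  have hquad := quadratic_form_le (m := m) (by omega) (v := r.eval 1 + a) hu
  rw [← ha] at hbessel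
  have hRpos := polyInner_self_pos hrne
  have hDdeg : (derivative (legendre (m + 1))).natDegree ≤ m := natDegree_derivative_legendre_le _
  have hMdeg : (derivative (legendre m)).natDegree ≤ m :=
    (natDegree_derivative_legendre_le m).trans (by omega)
  have hD := polyInner_derivative_legendre_succ_left m r hr
  have hM := polyInner_derivative_legendre m r hr
  have hDD := polyInner_derivative_legendre_self (m + 1)
  have hMM := polyInner_derivative_legendre_self m
  have hDM := polyInner_derivative_legendre_succ m
  have hLD := polyInner_legendre_eq_zero (m + 1) _ (Nat.lt_succ_of_le hDdeg)
  have hLM := polyInner_legendre_eq_zero (m + 1) _ (Nat.lt_succ_of_le hMdeg)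
  have hLr := polyInner_legendre_eq_zero (m + 1) _ (Nat.lt_succ_of_le hr)
  have hLL := polyInner_legendre_self (m + 1)
  have hD1 := legendre_derivative_eval_one (m + 1)
  have hM1 := legendre_derivative_eval_one m
  rw [← ha] at hD hM
  set D := derivative (legendre (m + 1))
  set M := derivative (legendre m)
  set c : ℝ := (a - 2 * r.eval 1) / (m + 1) ^ 2 with hc
  have hcm : c * (m + 1) ^ 2 = a - 2 * r.eval 1 := by
    rw [hc]
    field_simp
  refine lt_of_lt_of_le ?_ (hmax ((3 : ℝ) • r + c • (D + M)) ?_ ?_)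
  · rw [integral_functional_eq, hη]
    simp only [map_add, map_smul, LinearMap.add_apply, LinearMap.smul_apply, smul_eq_mul,
      polyInner_comm r, polyInner_comm M D, hD, hM, hDD, hMM, hDM,
      hLD, hLM, hLr, hLL]
    have hcsq : (3 * (r.eval 1 - a) + (r.eval 1 + a)) ^ 2 / (8 * (m + 1) ^ 2) =
        c ^ 2 * (m + 1) ^ 2 / 2 := by
      rw [hc]
      field_simp
      ring
    have hasq : (r.eval 1 + a - (r.eval 1 - a)) ^ 2 / (8 * (2 * m + 3)) =
        1 / 4 * a ^ 2 * (2 / (2 * (m + 1) + 1)) := by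
      field_simp
      ring
    push_cast
    rw [hcsq, hasq] at hquad
    nlinarith
  · exact (natDegree_add_le _ _).trans (max_le ((natDegree_smul_le _ _).trans hr)
      ((natDegree_smul_le _ _).trans ((natDegree_add_le _ _).trans (max_le hDdeg hMdeg))))
  · simp only [eval_add, eval_smul, smul_eq_mul, hD1, hM1, hη1]
    push_cast
    linear_combination hcm
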